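/- arXiv:1807.08091 — 2 statements merged into one kernel-verified Lean document; each statement's English description precedes it below -/
import Mathlib

section
/- Let l : ℝⁿ → ℝ be differentiable with l(0) = 0 and c_m-restricted strongly concave on the nonnegative orthant, let m ≥ 1, and let ρ = max_{j ∈ {1,…,n}} (max(∇_j l(0), 0))². Then for every set L* ⊆ {1,…,n} with |L*| ≤ m admitting an L*-maximizer ζ^(L*) of l, f(L*) = l(ζ^(L*)) satisfies f(L*) ≤ (1/(2·c_m)) · Σ_{j∈L*} (max(∇_j l(0), 0))² ≤ ρ·m/(2·c_m); equivalently, ρ·m/2 ≥ c_m · f(L*). -/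
open Finset

/-- componentwise nonnegativity -/
def Nonneg {n : ℕ} (x : Fin n → ℝ) : Prop := ∀ i, 0 ≤ x i

/-- the j-th partial derivative of l at x -/
noncomputable def pgrad {n : ℕ} (l : (Fin n → ℝ) → ℝ) (x : Fin n → ℝ) (j : Fin n) : ℝ :=
  fderiv ℝ l x (Pi.single j 1)

/-- `l` is `C`-restricted smooth (RSM) at sparsity level `k` on the nonnegative orthant -/
def RSM {n : ℕ} (l : (Fin n → ℝ) → ℝ) (k : ℕ) (C : ℝ) : Prop :=
  ∀ x y : Fin n → ℝ, Nonneg x → Nonneg y → {i | y i - x i ≠ 0}.ncard ≤ k →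
    l y - l x - fderiv ℝ l x (y - x) ≥ -(C / 2) * ∑ i, (y i - x i) ^ 2

/-- `l` is `c`-restricted strongly concave (RSC) at sparsity level `k`
on the nonnegative orthant -/
def RSC {n : ℕ} (l : (Fin n → ℝ) → ℝ) (k : ℕ) (c : ℝ) : Prop :=
  ∀ x y : Fin n → ℝ, Nonneg x → Nonneg y →
    {i | x i ≠ 0}.ncard ≤ k → {i | y i ≠ 0}.ncard ≤ k →
    l y - l x - fderiv ℝ l x (y - x) ≤ -(c / 2) * ∑ i, (y i - x i) ^ 2

/-- `ζ` is an `L`-maximizer of `l`: nonnegative, supported in `L`, and maximal among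
such points -/
def IsMaximizerOn {n : ℕ} (l : (Fin n → ℝ) → ℝ) (L : Finset (Fin n)) (ζ : Fin n → ℝ) : Prop :=
  Nonneg ζ ∧ (∀ i, ζ i ≠ 0 → i ∈ L) ∧
    ∀ w : Fin n → ℝ, Nonneg w → (∀ i, w i ≠ 0 → i ∈ L) → l w ≤ l ζ

/-- the derivative of `l` at `x` in direction `v` is the pairing of `v` with the gradient -/
theorem fderiv_eq_sum_pgrad {n : ℕ} (l : (Fin n → ℝ) → ℝ) (x v : Fin n → ℝ) :
    fderiv ℝ l x v = ∑ j, v j * pgrad l x j := by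
  conv_lhs => rw [pi_eq_sum_univ' v]
  simp only [map_sum, map_smul, smul_eq_mul, pgrad]

/-- the maximum over `z ≥ 0` of `z * g - (c / 2) * z ^ 2` is at most `(max g 0) ^ 2 / (2 * c)` -/
theorem mul_sub_sq_le_max_sq {c z : ℝ} (hc : 0 < c) (hz : 0 ≤ z) (g : ℝ) :
    z * g - c / 2 * z ^ 2 ≤ 1 / (2 * c) * (max g 0) ^ 2 := by
  have hg : z * g ≤ z * max g 0 := mul_le_mul_of_nonneg_left (le_max_left g 0) hz
  have hsq : 1 / (2 * c) * (max g 0) ^ 2 - (z * max g 0 - c / 2 * z ^ 2) =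
      1 / (2 * c) * (max g 0 - c * z) ^ 2 := by
    field_simp
    ring
  have hnonneg : 0 ≤ 1 / (2 * c) * (max g 0 - c * z) ^ 2 := by positivity
  linarith

/-- a restricted strongly concave `l` with `l 0 = 0` is bounded on sparse nonnegative vectors
by the positive part of its gradient at `0` -/
theorem RSC.le_sum_max_pgrad_sq {n k : ℕ} {l : (Fin n → ℝ) → ℝ} {c : ℝ} (h : RSC l k c)
    (hl0 : l 0 = 0) (hc : 0 < c) {L : Finset (Fin n)} (hL : L.card ≤ k) {z : Fin n → ℝ}
    (hz : Nonneg z) (hsupp : ∀ i, z i ≠ 0 → i ∈ L) :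
    l z ≤ 1 / (2 * c) * ∑ j ∈ L, (max (pgrad l 0 j) 0) ^ 2 := by
  have hcard : {i | z i ≠ 0}.ncard ≤ k := by
    refine le_trans (Set.ncard_le_ncard (t := (L : Set (Fin n))) (fun i hi => hsupp i hi)) ?_
    rwa [Set.ncard_coe_finset]
  have hle := h 0 z (fun _ => le_rfl) hz (by simp) hcard
  rw [hl0, sub_zero, sub_zero, fderiv_eq_sum_pgrad] at hle
  simp only [Pi.zero_apply, sub_zero] at hle
  have hsum : ∑ j, (z j * pgrad l 0 j - c / 2 * z j ^ 2) =
      ∑ j ∈ L, (z j * pgrad l 0 j - c / 2 * z j ^ 2) := by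
    refine (Finset.sum_subset (Finset.subset_univ L) fun j _ hj => ?_).symm
    have hzj : z j = 0 := by_contra fun hne => hj (hsupp j hne)
    simp [hzj]
  calc l z ≤ ∑ j, (z j * pgrad l 0 j - c / 2 * z j ^ 2) := by
        rw [Finset.sum_sub_distrib, ← Finset.mul_sum]
        linarith
    _ ≤ ∑ j ∈ L, 1 / (2 * c) * (max (pgrad l 0 j) 0) ^ 2 := by
        rw [hsum]
        exact Finset.sum_le_sum fun j _ => mul_sub_sq_le_max_sq hc (hz j) _
    _ = _ := (Finset.mul_sum _ _ _).symm

/-- Inequality (8): `f(L*) ≤ (1/(2c_m))·Σ_{j∈L*} (∇⁺_j l(0))² ≤ ρm/(2c_m)`, hence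
`ρm/2 ≥ c_m·f(L*)`, where `ρ` is the largest squared positive gradient coordinate at 0. -/
theorem opt_upper_bound_max_grad {n m : ℕ} (l : (Fin n → ℝ) → ℝ)
    (hl : Differentiable ℝ l) (hl0 : l 0 = 0)
    (cm : ℝ) (hcm : 0 < cm) (hRSC : RSC l m cm)
    (hm : 1 ≤ m)
    (ρ : ℝ) (hρ : IsGreatest {x : ℝ | ∃ j : Fin n, x = (max (pgrad l 0 j) 0) ^ 2} ρ) :
    ∀ (Lstar : Finset (Fin n)), Lstar.card ≤ m →
      ∀ ζ : Fin n → ℝ, IsMaximizerOn l Lstar ζ →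
        l ζ ≤ (1 / (2 * cm)) * ∑ j ∈ Lstar, (max (pgrad l 0 j) 0) ^ 2 ∧
        (1 / (2 * cm)) * ∑ j ∈ Lstar, (max (pgrad l 0 j) 0) ^ 2 ≤ ρ * m / (2 * cm) ∧
        cm * l ζ ≤ ρ * m / 2 := by
  intro L hL z ⟨hz, hsupp, _⟩
  have hfirst := hRSC.le_sum_max_pgrad_sq hl0 hcm hL hz hsupp
  have hρ0 : 0 ≤ ρ := by
    obtain ⟨j, hj⟩ := hρ.1
    exact hj ▸ sq_nonneg _
  have hsum : ∑ j ∈ L, (max (pgrad l 0 j) 0) ^ 2 ≤ ρ * m := by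
    calc ∑ j ∈ L, (max (pgrad l 0 j) 0) ^ 2 ≤ L.card • ρ :=
          Finset.sum_le_card_nsmul _ _ _ fun j _ => hρ.2 ⟨j, rfl⟩
      _ = ρ * L.card := by rw [nsmul_eq_mul, mul_comm]
      _ ≤ ρ * m := by gcongr
  have hsecond : 1 / (2 * cm) * ∑ j ∈ L, (max (pgrad l 0 j) 0) ^ 2 ≤ ρ * m / (2 * cm) := by
    rw [one_div_mul_eq_div]
    gcongr
  refine ⟨hfirst, hsecond, ?_⟩
  calc cm * l z ≤ cm * (ρ * m / (2 * cm)) := by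
        gcongr
        exact hfirst.trans hsecond
    _ = ρ * m / 2 := by field_simp
end

section
/- Let l : ℝⁿ → ℝ be differentiable with l(0) = 0, c_m-restricted strongly concave and C̃_1-restricted smooth on the nonnegative orthant, let m ≥ 1, let ρ = max_{j ∈ {1,…,n}} (max(∇_j l(0), 0))², and assume an L-maximizer ζ^(L) of l exists for every finite L (write f(L) = l(ζ^(L))). If c_m / C̃_1 ≥ 1/m, then for every L* ⊆ {1,…,n} with |L*| = m that maximizes f over sets of cardinality at most m, one has ρ/(2m) ≤ c_m · f(L*) ≤ ρ·m/2. -/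
open Finset

theorem nonneg_single {n : ℕ} (j : Fin n) {t : ℝ} (ht : 0 ≤ t) :
    Nonneg (Pi.single j t : Fin n → ℝ) := by
  have h : (0 : Fin n → ℝ) ≤ Pi.single j t := Pi.single_nonneg.mpr ht
  exact h

theorem fderiv_apply_eq_sum_pgrad {n : ℕ} (l : (Fin n → ℝ) → ℝ) (x v : Fin n → ℝ) :
    fderiv ℝ l x v = ∑ i, v i * pgrad l x i := by
  conv_lhs => rw [pi_eq_sum_univ' v]
  simp only [map_sum, map_smul, smul_eq_mul, pgrad]

/-- Under restricted strong concavity, `l` grows from the origin by at most the maximum of the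
separable quadratic upper model. -/
theorem RSC.mul_sub_le_sum {n k : ℕ} {l : (Fin n → ℝ) → ℝ} {c : ℝ} (h : RSC l k c) (hc : 0 < c)
    {L : Finset (Fin n)} (hL : L.card ≤ k) {z : Fin n → ℝ} (hz : Nonneg z)
    (hzL : ∀ i, z i ≠ 0 → i ∈ L) :
    c * (l z - l 0) ≤ ∑ i ∈ L, (max (pgrad l 0 i) 0) ^ 2 / 2 := by
  have hsupp : {i | z i ≠ 0}.ncard ≤ k := by
    refine le_trans ?_ hL
    rw [← Set.ncard_coe_finset L]
    exact Set.ncard_le_ncard hzL L.finite_toSet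
  have h1 := h 0 z (fun _ => le_rfl) hz (by simp) hsupp
  rw [sub_zero, fderiv_apply_eq_sum_pgrad] at h1
  have h2 : c * (l z - l 0) ≤ ∑ i, c * (z i * pgrad l 0 i - c / 2 * z i ^ 2) := by
    rw [← Finset.mul_sum, Finset.sum_sub_distrib, ← Finset.mul_sum]
    refine mul_le_mul_of_nonneg_left ?_ hc.le
    simp only [Pi.zero_apply, sub_zero] at h1
    linarith
  rw [← Finset.sum_subset (Finset.subset_univ L) fun i _ hi => by
    simp [not_not.mp (mt (hzL i) hi)]] at h2
  refine h2.trans (Finset.sum_le_sum fun i _ => ?_)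
  have h3 : z i * pgrad l 0 i ≤ z i * max (pgrad l 0 i) 0 :=
    mul_le_mul_of_nonneg_left (le_max_left _ _) (hz i)
  nlinarith [mul_le_mul_of_nonneg_left h3 hc.le, sq_nonneg (max (pgrad l 0 i) 0 - c * z i)]

/-- Under restricted smoothness, a gradient step of length `1 / C` along one coordinate from the
origin increases `l` by at least the maximum of the quadratic lower model. -/
theorem RSM.le_sub_single {n : ℕ} {l : (Fin n → ℝ) → ℝ} {C : ℝ} (h : RSM l 1 C) (hC : 0 < C)
    (j : Fin n) :
    (max (pgrad l 0 j) 0) ^ 2 / (2 * C) ≤ l (Pi.single j (max (pgrad l 0 j) 0 / C)) - l 0 := by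
  set p := max (pgrad l 0 j) 0 with hp
  have hp0 : 0 ≤ p / C := div_nonneg (le_max_right _ _) hC.le
  have hcard : {i | (Pi.single j (p / C) : Fin n → ℝ) i - (0 : Fin n → ℝ) i ≠ 0}.ncard ≤ 1 := by
    rw [← Set.ncard_singleton j]
    refine Set.ncard_le_ncard (fun i hi => ?_)
    by_contra hij
    simp_all
  have h1 := h 0 (Pi.single j (p / C)) (fun _ => le_rfl)
    (nonneg_single j hp0) hcard
  rw [sub_zero, fderiv_apply_eq_sum_pgrad] at h1
  simp only [Pi.single_apply, Pi.zero_apply, sub_zero, ite_pow, ite_mul, zero_mul,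
    Finset.sum_ite_eq', Finset.mem_univ, if_true, ne_eq, OfNat.ofNat_ne_zero, not_false_eq_true,
    zero_pow] at h1
  have h2 : p * pgrad l 0 j = p ^ 2 := by
    rcases max_cases (pgrad l 0 j) 0 with ⟨h, _⟩ | ⟨h, _⟩ <;> simp [hp, h, sq]
  have h3 : p / C * pgrad l 0 j - C / 2 * (p / C) ^ 2 = p ^ 2 / (2 * C) := by
    rw [div_mul_eq_mul_div, h2]
    field_simp
    ring
  linarith

/-- Range of thresholds: when `c_m/C̃₁ ≥ 1/m`, the quantity `c_m·f(L*)` lies in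
`[ρ/(2m), ρm/2]`. -/
theorem threshold_range {n m : ℕ} (l : (Fin n → ℝ) → ℝ)
    (hl : Differentiable ℝ l) (hl0 : l 0 = 0)
    (cm C1 : ℝ) (hcm : 0 < cm) (hC1 : 0 < C1)
    (hRSC : RSC l m cm) (hRSM : RSM l 1 C1)
    (hm : 1 ≤ m)
    (ρ : ℝ) (hρ : IsGreatest {x : ℝ | ∃ j : Fin n, x = (max (pgrad l 0 j) 0) ^ 2} ρ)
    (ζ : Finset (Fin n) → (Fin n → ℝ)) (hζ : ∀ L, IsMaximizerOn l L (ζ L))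
    (hκ : cm / C1 ≥ 1 / m) :
    ∀ Lstar : Finset (Fin n), Lstar.card = m →
      (∀ T : Finset (Fin n), T.card ≤ m → l (ζ T) ≤ l (ζ Lstar)) →
      ρ / (2 * m) ≤ cm * l (ζ Lstar) ∧ cm * l (ζ Lstar) ≤ ρ * m / 2 := by
  intro Lstar hcard hmax
  have hm0 : (0 : ℝ) < m := by exact_mod_cast hm
  obtain ⟨⟨j, hj⟩, hub⟩ := hρ
  constructor
  · have h1 := hRSM.le_sub_single hC1 j
    rw [← hj, hl0, sub_zero] at h1
    have hp : 0 ≤ max (pgrad l 0 j) 0 / C1 := div_nonneg (le_max_right _ _) hC1.le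
    have h2 := (hζ {j}).2.2 (Pi.single j (max (pgrad l 0 j) 0 / C1))
      (nonneg_single j hp) fun i hi => by
        by_contra hij
        simp_all
    have h3 : ρ / (2 * C1) ≤ l (ζ Lstar) :=
      h1.trans (h2.trans (hmax {j} (by simpa using hm)))
    have hρ0 : 0 ≤ ρ := hj ▸ sq_nonneg _
    calc ρ / (2 * m) = 1 / m * (ρ / 2) := by field_simp
      _ ≤ cm / C1 * (ρ / 2) := mul_le_mul_of_nonneg_right hκ (by positivity)
      _ = cm * (ρ / (2 * C1)) := by field_simp
      _ ≤ cm * l (ζ Lstar) := mul_le_mul_of_nonneg_left h3 hcm.le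
  · have h1 := hRSC.mul_sub_le_sum hcm hcard.le (hζ Lstar).1 (hζ Lstar).2.1
    rw [hl0, sub_zero] at h1
    refine h1.trans ((Finset.sum_le_card_nsmul Lstar _ (ρ / 2) fun i _ => ?_).trans_eq ?_)
    · exact div_le_div_of_nonneg_right (hub ⟨i, rfl⟩) zero_le_two
    · rw [hcard, nsmul_eq_mul]
      ring
end
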